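/- Let T : ℝ^𝒳 → ℝ^𝒳 be a linear coherent map that satisfies the reachability condition (R1). Then there is a positive integer n such that ‖(T|_{Aᶜ})ⁿ‖ < 1, where ‖·‖ is the operator norm on maps from ℝ^{Aᶜ} to ℝ^{Aᶜ} induced by the supremum norm. -/

import Mathlib

open Function Set

/-- A map `T : ℝ^𝒳 → ℝ^𝒳` is *coherent* if it is non-negatively homogeneous (C1),
super-additive (C2), and dominates the pointwise minimum (C3). -/
def Coherent {X : Type*} [Fintype X] [Nonempty X] (T : (X → ℝ) → (X → ℝ)) : Prop :=
  (∀ (α : ℝ), 0 ≤ α → ∀ f, T (α • f) = α • T f) ∧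
  (∀ f g, T f + T g ≤ T (f + g)) ∧
  (∀ (f : X → ℝ) (x : X), (⨅ y, f y) ≤ T f x)

/-- The reachability condition (R1) with respect to the target set `A`. -/
def Reach {X : Type*} (A : Set X) (T : (X → ℝ) → (X → ℝ)) : Prop :=
  ∀ x ∈ Aᶜ, ∃ n : ℕ, 0 < n ∧ 0 < T^[n] (A.indicator 1) x

/-- The restriction `M|_{Aᶜ}` of a map `M : ℝ^𝒳 → ℝ^𝒳` to `ℝ^{Aᶜ}`: the argument `f` is
extended by zero to `𝒳` (this extension is `g·𝟙_{Aᶜ}` for any `g` with `g|_{Aᶜ} = f`),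
`M` is applied, and the result is restricted to `Aᶜ`. -/
noncomputable def restr {X : Type*} (A : Set X) (M : (X → ℝ) → (X → ℝ)) :
    (↥(Aᶜ) → ℝ) → (↥(Aᶜ) → ℝ) :=
  fun f x => M (Function.extend (Subtype.val : ↥(Aᶜ) → X) f 0) x.val

/-- A positive operator on `ℝ^ι` attains its sup-operator norm at the constant function `1`. -/
lemma opNorm_le_norm_apply_one {ι : Type*} [Fintype ι] (L : (ι → ℝ) →L[ℝ] (ι → ℝ))
    (hL : Monotone L) : ‖L‖ ≤ ‖L 1‖ := by
  refine L.opNorm_le_bound (norm_nonneg _) fun f => ?_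
  refine (pi_norm_le_iff_of_nonneg (by positivity)).2 fun x => ?_
  have hf : ∀ y, |f y| ≤ ‖f‖ := fun y => norm_le_pi_norm f y
  have upper : L f x ≤ ‖f‖ * L 1 x := by
    have h : f ≤ ‖f‖ • (1 : ι → ℝ) := fun y => by simpa using (abs_le.1 (hf y)).2
    simpa using hL h x
  have lower : -(‖f‖ * L 1 x) ≤ L f x := by
    have h : -(‖f‖ • (1 : ι → ℝ)) ≤ f := fun y => by simpa using (abs_le.1 (hf y)).1
    simpa using hL h x
  have hx : L 1 x ≤ ‖L 1‖ := (le_abs_self _).trans (norm_le_pi_norm (L 1) x)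
  rw [Real.norm_eq_abs, mul_comm]
  exact (abs_le.2 ⟨lower, upper⟩).trans (mul_le_mul_of_nonneg_left hx (norm_nonneg f))

lemma Coherent.monotone {X : Type*} [Fintype X] [Nonempty X] {T : (X → ℝ) → (X → ℝ)}
    (hT : Coherent T) : Monotone T := by
  intro f g hfg x
  have hadd := hT.2.1 f (g - f) x
  rw [add_sub_cancel] at hadd
  have hnonneg : 0 ≤ T (g - f) x :=
    (le_ciInf fun y => sub_nonneg.2 (hfg y)).trans (hT.2.2 (g - f) x)
  simp only [Pi.add_apply] at hadd
  linarith

lemma Coherent.map_one {X : Type*} [Fintype X] [Nonempty X] {T : (X → ℝ) → (X → ℝ)}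
    (hT : Coherent T) (hlin : IsLinearMap ℝ T) : T 1 = 1 := by
  funext x
  have hlower := hT.2.2 1 x
  have hupper := hT.2.2 (-1) x
  rw [hlin.map_neg] at hupper
  simp only [Pi.one_apply, Pi.neg_apply, ciInf_const] at hlower hupper ⊢
  linarith

lemma Coherent.restr_monotone {X : Type*} [Fintype X] [Nonempty X] {T : (X → ℝ) → (X → ℝ)}
    (hT : Coherent T) (A : Set X) : Monotone (restr A T) := by
  intro f g hfg x
  refine hT.monotone (fun y => ?_) x.val
  by_cases hy : y ∈ Aᶜ
  · lift y to ↥(Aᶜ) using hy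
    simpa only [Subtype.val_injective.extend_apply] using hfg y
  · rw [extend_apply' _ _ _ (by simpa using hy), extend_apply' _ _ _ (by simpa using hy)]

/-- The extension by zero of a function bounded by a nonnegative `g` on `Aᶜ` is bounded by `g`. -/
lemma extend_zero_le {X : Type*} {A : Set X} {f : ↥(Aᶜ) → ℝ} {g : X → ℝ} (hg : 0 ≤ g)
    (hfg : ∀ x : ↥(Aᶜ), f x ≤ g x) : extend Subtype.val f 0 ≤ g := by
  intro y
  by_cases hy : y ∈ Aᶜ
  · exact (Subtype.val_injective.extend_apply f 0 ⟨y, hy⟩).trans_le (hfg ⟨y, hy⟩)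
  · rw [extend_apply' _ _ _ (by simpa using hy)]
    exact hg y

/-- The mass that has stayed in `Aᶜ` for `n` steps is at most the mass not in `A` after `n`
steps. -/
lemma restr_iterate_one_le {X : Type*} [Fintype X] [Nonempty X] {T : (X → ℝ) → (X → ℝ)}
    (hT : Coherent T) (hlin : IsLinearMap ℝ T) (A : Set X) (n : ℕ) :
    T^[n] (A.indicator 1) ≤ 1 ∧
      ∀ x : ↥(Aᶜ), (restr A T)^[n] 1 x ≤ 1 - T^[n] (A.indicator 1) x := by
  induction n with
  | zero =>
    refine ⟨fun y => indicator_apply_le' (fun _ => le_rfl) fun _ => zero_le_one, fun x => ?_⟩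
    simp [indicator_of_notMem x.prop]
  | succ n ih =>
    obtain ⟨hle, hres⟩ := ih
    simp only [iterate_succ_apply']
    refine ⟨(hT.monotone hle).trans_eq (hT.map_one hlin), fun x => ?_⟩
    have h := hT.monotone (extend_zero_le (g := 1 - T^[n] (A.indicator 1))
      (sub_nonneg.2 hle) hres) x.val
    rwa [hlin.map_sub, hT.map_one hlin] at h

theorem stmt12 {X : Type*} [Fintype X] [Nonempty X] (A : Set X)
    (hA : A.Nonempty) (hAc : (Aᶜ : Set X).Nonempty) [Fintype ↥(Aᶜ : Set X)]
    (T : (X → ℝ) → (X → ℝ)) (hlin : IsLinearMap ℝ T) (hT : Coherent T)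
    (hR : Reach A T)
    (M : (↥(Aᶜ) → ℝ) →L[ℝ] (↥(Aᶜ) → ℝ)) (hM : ∀ f, M f = restr A T f) :
    ∃ n : ℕ, 0 < n ∧ ‖M ^ n‖ < 1 := by
  have hcoe : ⇑M = restr A T := funext hM
  have hmono : Monotone M := hcoe ▸ hT.restr_monotone A
  have hpow : ∀ n, ⇑(M ^ n) = M^[n] := FunLike.coe_pow_eq_iterate M
  have hM1 : M 1 ≤ 1 := fun x => by
    rw [hM]
    exact (hT.monotone (extend_zero_le zero_le_one fun _ => le_rfl) x.val).trans_eq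
      (congrFun (hT.map_one hlin) x.val)
  have hanti : Antitone fun n => M^[n] 1 := hmono.antitone_iterate_of_map_le hM1
  choose n hn hpos using fun x : ↥(Aᶜ) => hR x.val x.prop
  refine ⟨1 + ∑ x, n x, by omega, ?_⟩
  refine (opNorm_le_norm_apply_one _ (by rw [hpow]; exact hmono.iterate _)).trans_lt ?_
  rw [hpow, pi_norm_lt_iff one_pos]
  intro x
  have hnonneg : 0 ≤ M^[1 + ∑ x, n x] 1 x := by
    have h := hmono.iterate (1 + ∑ x, n x) (zero_le_one : (0 : ↥(Aᶜ) → ℝ) ≤ 1) x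
    rwa [← hpow, map_zero, hpow] at h
  have hle : n x ≤ 1 + ∑ x, n x :=
    (Finset.single_le_sum (fun _ _ => Nat.zero_le _) (Finset.mem_univ x)).trans (by omega)
  have hstep := (restr_iterate_one_le hT hlin A (n x)).2 x
  rw [← hcoe] at hstep
  rw [Real.norm_eq_abs, abs_of_nonneg hnonneg]
  have := hanti hle x
  have := hpos x
  linarith
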